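/- arXiv:1708.04720 — 5 statements merged into one kernel-verified Lean document; each statement's English description precedes it below -/
import Mathlib

section
/- Let n ≥ 3 and m ≥ 2 be integers, let κ, λ, G be real constants, and let I ⊆ ℝ be a nonempty open interval. Let φ : I → ℝ be twice differentiable and nowhere vanishing, and let f : I → ℝ be twice differentiable and everywhere positive, satisfying φ(ξ)·f'(ξ) = G·f(ξ) for all ξ ∈ I. If (φ, f) satisfy system (A) on I, then φ satisfies system (B) on I. -/
/-- If (φ, f) satisfy system (A) on the nonempty open interval I = Ioo a b,
with φ twice differentiable and nowhere vanishing, f twice differentiable and positive,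
and φ·f' = G·f on I, then φ satisfies system (B) on I. -/
theorem stmt0 (n m : ℕ) (hn : 3 ≤ n) (hm : 2 ≤ m) (κ lam G : ℝ)
    (a b : ℝ) (hab : a < b) (φ f : ℝ → ℝ)
    (hφ : ∀ ξ ∈ Set.Ioo a b, DifferentiableAt ℝ φ ξ)
    (hφ' : ∀ ξ ∈ Set.Ioo a b, DifferentiableAt ℝ (deriv φ) ξ)
    (hf : ∀ ξ ∈ Set.Ioo a b, DifferentiableAt ℝ f ξ)
    (hf' : ∀ ξ ∈ Set.Ioo a b, DifferentiableAt ℝ (deriv f) ξ)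
    (hφ0 : ∀ ξ ∈ Set.Ioo a b, φ ξ ≠ 0)
    (hfpos : ∀ ξ ∈ Set.Ioo a b, 0 < f ξ)
    (hrel : ∀ ξ ∈ Set.Ioo a b, φ ξ * deriv f ξ = G * f ξ)
    (hA1 : ∀ ξ ∈ Set.Ioo a b,
      ((n : ℝ) - 2) * f ξ * deriv (deriv φ) ξ - (m : ℝ) * deriv (deriv f) ξ * φ ξ
        - 2 * (m : ℝ) * deriv φ ξ * deriv f ξ = 0)
    (hA2 : ∀ ξ ∈ Set.Ioo a b,
      f ξ * φ ξ * deriv (deriv φ) ξ - ((n : ℝ) - 1) * f ξ * (deriv φ ξ) ^ 2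
        + (m : ℝ) * φ ξ * deriv φ ξ * deriv f ξ = κ * lam * f ξ)
    (hA3 : ∀ ξ ∈ Set.Ioo a b,
      ((n : ℝ) - 2) * f ξ * φ ξ * deriv φ ξ * deriv f ξ
        - ((m : ℝ) - 1) * (φ ξ) ^ 2 * (deriv f ξ) ^ 2
        - f ξ * deriv (deriv f) ξ * (φ ξ) ^ 2 = κ * lam * (f ξ) ^ 2) :
    (∀ ξ ∈ Set.Ioo a b,
      ((n : ℝ) - 2) * φ ξ * deriv (deriv φ) ξ - (m : ℝ) * G * deriv φ ξ = (m : ℝ) * G ^ 2) ∧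
    (∀ ξ ∈ Set.Ioo a b,
      φ ξ * deriv (deriv φ) ξ - ((n : ℝ) - 1) * (deriv φ ξ) ^ 2 + (m : ℝ) * G * deriv φ ξ
        = κ * lam) ∧
    (∀ ξ ∈ Set.Ioo a b,
      ((n : ℝ) - 1) * G * deriv φ ξ - (m : ℝ) * G ^ 2 = κ * lam) := by
  have key : ∀ ξ ∈ Set.Ioo a b,
      deriv (deriv f) ξ * (φ ξ) ^ 2 = G ^ 2 * f ξ - deriv φ ξ * G * f ξ := by
    intro ξ hξ
    have h1 : HasDerivAt (fun x => φ x * deriv f x)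
        (deriv φ ξ * deriv f ξ + φ ξ * deriv (deriv f) ξ) ξ :=
      (hφ ξ hξ).hasDerivAt.mul (hf' ξ hξ).hasDerivAt
    have h2 : HasDerivAt (fun x => G * f x) (G * deriv f ξ) ξ :=
      (hf ξ hξ).hasDerivAt.const_mul G
    have heq : (fun x => φ x * deriv f x) =ᶠ[nhds ξ] (fun x => G * f x) := by
      filter_upwards [isOpen_Ioo.mem_nhds hξ] with x hx using hrel x hx
    have hK := h1.unique (h2.congr_of_eventuallyEq heq)
    linear_combination φ ξ * hK + (G - deriv φ ξ) * hrel ξ hξ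
  refine ⟨fun ξ hξ => ?_, fun ξ hξ => ?_, fun ξ hξ => ?_⟩
  · apply mul_left_cancel₀ (hfpos ξ hξ).ne'
    linear_combination φ ξ * hA1 ξ hξ + (m : ℝ) * key ξ hξ
      + 2 * (m : ℝ) * deriv φ ξ * hrel ξ hξ
  · apply mul_left_cancel₀ (hfpos ξ hξ).ne'
    linear_combination hA2 ξ hξ - (m : ℝ) * deriv φ ξ * hrel ξ hξ
  · apply mul_left_cancel₀ (pow_ne_zero 2 (hfpos ξ hξ).ne')
    linear_combination hA3 ξ hξ + f ξ * key ξ hξ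
      - ((n : ℝ) - 2) * f ξ * deriv φ ξ * hrel ξ hξ
      + ((m : ℝ) - 1) * (φ ξ * deriv f ξ + G * f ξ) * hrel ξ hξ
end

section
/- Let n ≥ 3 and m ≥ 2 be integers, let κ, λ, G be real constants, and let I ⊆ ℝ be a nonempty open interval. Let φ : I → ℝ be twice differentiable and nowhere vanishing, and let f : I → ℝ be twice differentiable and everywhere positive, satisfying φ(ξ)·f'(ξ) = G·f(ξ) for all ξ ∈ I. If φ satisfies system (B) on I, then (φ, f) satisfy system (A) on I. -/
/-- If φ satisfies system (B) on the nonempty open interval I = Ioo a b,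
with φ twice differentiable and nowhere vanishing, f twice differentiable and positive,
and φ·f' = G·f on I, then (φ, f) satisfy system (A) on I. -/
theorem stmt1 (n m : ℕ) (hn : 3 ≤ n) (hm : 2 ≤ m) (κ lam G : ℝ)
    (a b : ℝ) (hab : a < b) (φ f : ℝ → ℝ)
    (hφ : ∀ ξ ∈ Set.Ioo a b, DifferentiableAt ℝ φ ξ)
    (hφ' : ∀ ξ ∈ Set.Ioo a b, DifferentiableAt ℝ (deriv φ) ξ)
    (hf : ∀ ξ ∈ Set.Ioo a b, DifferentiableAt ℝ f ξ)
    (hf' : ∀ ξ ∈ Set.Ioo a b, DifferentiableAt ℝ (deriv f) ξ)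
    (hφ0 : ∀ ξ ∈ Set.Ioo a b, φ ξ ≠ 0)
    (hfpos : ∀ ξ ∈ Set.Ioo a b, 0 < f ξ)
    (hrel : ∀ ξ ∈ Set.Ioo a b, φ ξ * deriv f ξ = G * f ξ)
    (hB1 : ∀ ξ ∈ Set.Ioo a b,
      ((n : ℝ) - 2) * φ ξ * deriv (deriv φ) ξ - (m : ℝ) * G * deriv φ ξ = (m : ℝ) * G ^ 2)
    (hB2 : ∀ ξ ∈ Set.Ioo a b,
      φ ξ * deriv (deriv φ) ξ - ((n : ℝ) - 1) * (deriv φ ξ) ^ 2 + (m : ℝ) * G * deriv φ ξ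
        = κ * lam)
    (hB3 : ∀ ξ ∈ Set.Ioo a b,
      ((n : ℝ) - 1) * G * deriv φ ξ - (m : ℝ) * G ^ 2 = κ * lam) :
    (∀ ξ ∈ Set.Ioo a b,
      ((n : ℝ) - 2) * f ξ * deriv (deriv φ) ξ - (m : ℝ) * deriv (deriv f) ξ * φ ξ
        - 2 * (m : ℝ) * deriv φ ξ * deriv f ξ = 0) ∧
    (∀ ξ ∈ Set.Ioo a b,
      f ξ * φ ξ * deriv (deriv φ) ξ - ((n : ℝ) - 1) * f ξ * (deriv φ ξ) ^ 2
        + (m : ℝ) * φ ξ * deriv φ ξ * deriv f ξ = κ * lam * f ξ) ∧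
    (∀ ξ ∈ Set.Ioo a b,
      ((n : ℝ) - 2) * f ξ * φ ξ * deriv φ ξ * deriv f ξ
        - ((m : ℝ) - 1) * (φ ξ) ^ 2 * (deriv f ξ) ^ 2
        - f ξ * deriv (deriv f) ξ * (φ ξ) ^ 2 = κ * lam * (f ξ) ^ 2) := by
  have hE : ∀ ξ ∈ Set.Ioo a b,
      deriv φ ξ * deriv f ξ + φ ξ * deriv (deriv f) ξ = G * deriv f ξ := by
    intro ξ hξ
    have h1 : (fun x => φ x * deriv f x) =ᶠ[nhds ξ] (fun x => G * f x) := by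
      filter_upwards [Ioo_mem_nhds hξ.1 hξ.2] with x hx using hrel x hx
    have h2 := (hφ ξ hξ).hasDerivAt.mul (hf' ξ hξ).hasDerivAt
    have h3 := ((hf ξ hξ).hasDerivAt.const_mul G).congr_of_eventuallyEq h1
    exact h2.unique h3
  refine ⟨fun ξ hξ => ?_, fun ξ hξ => ?_, fun ξ hξ => ?_⟩
  · apply mul_left_cancel₀ (hφ0 ξ hξ)
    linear_combination f ξ * hB1 ξ hξ - (m : ℝ) * φ ξ * hE ξ hξ
      + (-(m : ℝ) * deriv φ ξ - m * G) * hrel ξ hξ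
  · linear_combination f ξ * hB2 ξ hξ + (m : ℝ) * deriv φ ξ * hrel ξ hξ
  · linear_combination f ξ ^ 2 * hB3 ξ hξ - f ξ * φ ξ * hE ξ hξ
      + (((n : ℝ) - 1) * f ξ * deriv φ ξ - ((m : ℝ) - 1) * (φ ξ * deriv f ξ + G * f ξ)
        - f ξ * G) * hrel ξ hξ
end

section
/- Let n ≥ 3 and m ≥ 2 be integers, let λ, G be real constants, let κ ∈ {−1, 1}, and let I ⊆ ℝ be a nonempty open interval. Let φ : I → ℝ be twice differentiable and nowhere vanishing, satisfying system (B) on I. Then exactly one of the following holds: (1) G = 0, λ = 0, and φ is constant on I; or (2) G ≠ 0, κ·λ = −(m+n−1)·G², and there exists C ∈ ℝ such that φ(ξ) = −G·ξ + C for all ξ ∈ I. -/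
/-- a twice differentiable nowhere-vanishing solution φ of system (B)
on a nonempty open interval satisfies exactly one of:
(1) G = 0, λ = 0 and φ is constant; or
(2) G ≠ 0, κλ = −(m+n−1)G² and φ(ξ) = −Gξ + C. -/
theorem stmt4 (n m : ℕ) (hn : 3 ≤ n) (hm : 2 ≤ m) (κ lam G : ℝ)
    (hκ : κ = -1 ∨ κ = 1) (a b : ℝ) (hab : a < b) (φ : ℝ → ℝ)
    (hφ : ∀ ξ ∈ Set.Ioo a b, DifferentiableAt ℝ φ ξ)
    (hφ' : ∀ ξ ∈ Set.Ioo a b, DifferentiableAt ℝ (deriv φ) ξ)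
    (hφ0 : ∀ ξ ∈ Set.Ioo a b, φ ξ ≠ 0)
    (hB1 : ∀ ξ ∈ Set.Ioo a b,
      ((n : ℝ) - 2) * φ ξ * deriv (deriv φ) ξ - (m : ℝ) * G * deriv φ ξ = (m : ℝ) * G ^ 2)
    (hB2 : ∀ ξ ∈ Set.Ioo a b,
      φ ξ * deriv (deriv φ) ξ - ((n : ℝ) - 1) * (deriv φ ξ) ^ 2 + (m : ℝ) * G * deriv φ ξ
        = κ * lam)
    (hB3 : ∀ ξ ∈ Set.Ioo a b,
      ((n : ℝ) - 1) * G * deriv φ ξ - (m : ℝ) * G ^ 2 = κ * lam) :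
    Xor'
      (G = 0 ∧ lam = 0 ∧ ∃ c : ℝ, ∀ ξ ∈ Set.Ioo a b, φ ξ = c)
      (G ≠ 0 ∧ κ * lam = -((m : ℝ) + (n : ℝ) - 1) * G ^ 2 ∧
        ∃ C : ℝ, ∀ ξ ∈ Set.Ioo a b, φ ξ = -G * ξ + C) := by
  have hn' : (3 : ℝ) ≤ n := by exact_mod_cast hn
  have hm' : (2 : ℝ) ≤ m := by exact_mod_cast hm
  have hκ0 : κ ≠ 0 := by rcases hκ with h | h <;> rw [h] <;> norm_num
  have hmid : (a + b) / 2 ∈ Set.Ioo a b := ⟨by linarith, by linarith⟩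
  have hlam : G = 0 → lam = 0 := by
    intro hG
    have h := hB3 _ hmid
    rw [hG] at h
    have h2 : κ * lam = 0 := by linarith
    exact (mul_eq_zero.mp h2).resolve_left hκ0
  -- the first derivative is constantly -G
  have hd : ∀ ξ ∈ Set.Ioo a b, deriv φ ξ = -G := by
    intro ξ hξ
    by_cases hG : G = 0
    · have h1 := hB1 ξ hξ
      have h2 := hB2 ξ hξ
      rw [hlam hG] at h2
      rw [hG] at h1 h2 ⊢
      have h3 : ((n : ℝ) - 2) * (φ ξ * deriv (deriv φ) ξ) = 0 := by linarith
      have h4 : φ ξ * deriv (deriv φ) ξ = 0 :=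
        (mul_eq_zero.mp h3).resolve_left (by linarith)
      have h5 : ((n : ℝ) - 1) * (deriv φ ξ) ^ 2 = 0 := by linarith
      have h6 : (deriv φ ξ) ^ 2 = 0 := (mul_eq_zero.mp h5).resolve_left (by linarith)
      simpa using h6
    · have hne : ((n : ℝ) - 1) * G ≠ 0 := mul_ne_zero (by linarith) hG
      have hev : deriv φ =ᶠ[nhds ξ] fun _ => deriv φ ξ := by
        filter_upwards [isOpen_Ioo.mem_nhds hξ] with x hx
        have h1 := hB3 x hx
        have h2 := hB3 ξ hξ
        exact mul_left_cancel₀ hne (by linarith)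
      have h0 : deriv (deriv φ) ξ = 0 := by
        rw [hev.deriv_eq]; simp
      have h1 := hB1 ξ hξ
      rw [h0] at h1
      have hmG : (m : ℝ) * G ≠ 0 := mul_ne_zero (by linarith) hG
      exact mul_left_cancel₀ hmG (by linarith)
  have hder : ∀ ξ ∈ Set.Ioo a b, HasDerivAt (fun x => φ x + G * x) 0 ξ := by
    intro ξ hξ
    have h := (hφ ξ hξ).hasDerivAt.add ((hasDerivAt_id ξ).const_mul G)
    rw [hd ξ hξ] at h
    have h0 : -G + G * 1 = 0 := by ring
    rw [h0] at h
    exact h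
  obtain ⟨C, hC⟩ := isOpen_Ioo.exists_is_const_of_deriv_eq_zero isPreconnected_Ioo
    (fun ξ hξ => (hder ξ hξ).differentiableAt.differentiableWithinAt)
    (fun ξ hξ => (hder ξ hξ).deriv)
  by_cases hG : G = 0
  · refine Or.inl ⟨⟨hG, hlam hG, C, fun ξ hξ => ?_⟩, fun h => h.1 hG⟩
    have := hC ξ hξ
    simpa [hG] using this
  · refine Or.inr ⟨⟨hG, ?_, C, fun ξ hξ => ?_⟩, fun h => hG h.1⟩
    · have h := hB3 _ hmid
      rw [hd _ hmid] at h
      rw [← h]; ring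
    · have := hC ξ hξ
      linarith
end

section
/- Let n ≥ 3 and m ≥ 2 be integers, let κ ∈ {−1, 1}, let λ be a nonzero real constant, let G be a real constant, and let I ⊆ ℝ be a nonempty open interval. Let φ : I → ℝ be twice differentiable and nowhere vanishing, and let f : I → ℝ be twice differentiable and everywhere positive, satisfying φ(ξ)·f'(ξ) = G·f(ξ) for all ξ ∈ I, and such that (φ, f) satisfy system (A) on I. Then G ≠ 0, κ·λ = −(m+n−1)·G², and there exist constants C ∈ ℝ and Θ ≠ 0 such that φ(ξ) = −G·ξ + C and f(ξ)·(−G·ξ + C) = Θ for all ξ ∈ I. -/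
/-- for λ ≠ 0, a solution (φ, f) of system (A) on a nonempty open interval,
with φ·f' = G·f, satisfies G ≠ 0, κλ = −(m+n−1)G², φ(ξ) = −Gξ + C and
f(ξ)·(−Gξ + C) = Θ for constants C ∈ ℝ and Θ ≠ 0. -/
theorem stmt8 (n m : ℕ) (hn : 3 ≤ n) (hm : 2 ≤ m) (κ lam G : ℝ)
    (hκ : κ = -1 ∨ κ = 1) (hlam : lam ≠ 0)
    (a b : ℝ) (hab : a < b) (φ f : ℝ → ℝ)
    (hφ : ∀ ξ ∈ Set.Ioo a b, DifferentiableAt ℝ φ ξ)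
    (hφ' : ∀ ξ ∈ Set.Ioo a b, DifferentiableAt ℝ (deriv φ) ξ)
    (hf : ∀ ξ ∈ Set.Ioo a b, DifferentiableAt ℝ f ξ)
    (hf' : ∀ ξ ∈ Set.Ioo a b, DifferentiableAt ℝ (deriv f) ξ)
    (hφ0 : ∀ ξ ∈ Set.Ioo a b, φ ξ ≠ 0)
    (hfpos : ∀ ξ ∈ Set.Ioo a b, 0 < f ξ)
    (hrel : ∀ ξ ∈ Set.Ioo a b, φ ξ * deriv f ξ = G * f ξ)
    (hA1 : ∀ ξ ∈ Set.Ioo a b,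
      ((n : ℝ) - 2) * f ξ * deriv (deriv φ) ξ - (m : ℝ) * deriv (deriv f) ξ * φ ξ
        - 2 * (m : ℝ) * deriv φ ξ * deriv f ξ = 0)
    (hA2 : ∀ ξ ∈ Set.Ioo a b,
      f ξ * φ ξ * deriv (deriv φ) ξ - ((n : ℝ) - 1) * f ξ * (deriv φ ξ) ^ 2
        + (m : ℝ) * φ ξ * deriv φ ξ * deriv f ξ = κ * lam * f ξ)
    (hA3 : ∀ ξ ∈ Set.Ioo a b,
      ((n : ℝ) - 2) * f ξ * φ ξ * deriv φ ξ * deriv f ξ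
        - ((m : ℝ) - 1) * (φ ξ) ^ 2 * (deriv f ξ) ^ 2
        - f ξ * deriv (deriv f) ξ * (φ ξ) ^ 2 = κ * lam * (f ξ) ^ 2) :
    G ≠ 0 ∧ κ * lam = -((m : ℝ) + (n : ℝ) - 1) * G ^ 2 ∧
      ∃ C Θ : ℝ, Θ ≠ 0 ∧
        ∀ ξ ∈ Set.Ioo a b, φ ξ = -G * ξ + C ∧ f ξ * (-G * ξ + C) = Θ := by
  have hmem : ∀ ξ ∈ Set.Ioo a b, Set.Ioo a b ∈ nhds ξ := fun ξ h => isOpen_Ioo.mem_nhds h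
  have hn' : (3 : ℝ) ≤ n := by exact_mod_cast hn
  have hm' : (2 : ℝ) ≤ m := by exact_mod_cast hm
  have hκl : κ * lam ≠ 0 := by
    apply mul_ne_zero _ hlam
    rcases hκ with h | h <;> rw [h] <;> norm_num
  have hk : ∀ ξ ∈ Set.Ioo a b,
      deriv φ ξ * deriv f ξ + φ ξ * deriv (deriv f) ξ = G * deriv f ξ := by
    intro ξ h
    have h1 := (hφ ξ h).hasDerivAt.mul (hf' ξ h).hasDerivAt
    have h2 := (hf ξ h).hasDerivAt.const_mul G
    have h3 : (φ * deriv f) =ᶠ[nhds ξ] fun x => G * f x := by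
      filter_upwards [hmem ξ h] with x hx
      exact hrel x hx
    exact (h1.congr_of_eventuallyEq h3.symm).unique h2
  have hp : ∀ ξ ∈ Set.Ioo a b,
      ((n : ℝ) - 1) * G * deriv φ ξ = κ * lam + m * G ^ 2 := by
    intro ξ h
    have hf0 : (f ξ) ^ 2 ≠ 0 := pow_ne_zero _ (hfpos ξ h).ne'
    apply mul_left_cancel₀ hf0
    linear_combination hA3 ξ h + (f ξ) * (φ ξ) * hk ξ h
      - (-(((n : ℝ) - 1) * f ξ * deriv φ ξ) * -1
        - ((m : ℝ) - 1) * (φ ξ * deriv f ξ + G * f ξ) - G * f ξ) * hrel ξ h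
  obtain ⟨x0, hx0⟩ : ∃ x, x ∈ Set.Ioo a b := Set.nonempty_Ioo.2 hab
  have hG : G ≠ 0 := by
    intro h0
    have := hp x0 hx0
    rw [h0] at this
    apply hκl
    linarith
  have hnG : ((n : ℝ) - 1) * G ≠ 0 := mul_ne_zero (by linarith) hG
  have hdd : ∀ ξ ∈ Set.Ioo a b, deriv (deriv φ) ξ = 0 := by
    intro ξ h
    have h3 : deriv φ =ᶠ[nhds ξ] fun _ => (κ * lam + m * G ^ 2) / (((n : ℝ) - 1) * G) := by
      filter_upwards [hmem ξ h] with x hx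
      rw [eq_div_iff hnG, ← hp x hx]
      ring
    rw [h3.deriv_eq, deriv_const]
  have hpG : ∀ ξ ∈ Set.Ioo a b, deriv φ ξ = -G := by
    intro ξ h
    have hc : (m : ℝ) * G * f ξ ≠ 0 :=
      mul_ne_zero (mul_ne_zero (by linarith) hG) (hfpos ξ h).ne'
    have h1 := hA1 ξ h
    rw [hdd ξ h] at h1
    apply mul_left_cancel₀ hc
    linear_combination -φ ξ * h1 - (m : ℝ) * φ ξ * hk ξ h
      - (m : ℝ) * (G + deriv φ ξ) * hrel ξ h
  have hφd : ∀ ξ ∈ Set.Ioo a b, HasDerivAt φ (-G) ξ := fun ξ h => by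
    have := (hφ ξ h).hasDerivAt
    rwa [hpG ξ h] at this
  have hconst : ∀ g : ℝ → ℝ, (∀ ξ ∈ Set.Ioo a b, HasDerivAt g 0 ξ) →
      ∀ ξ ∈ Set.Ioo a b, g ξ = g x0 := by
    intro g hg ξ h
    exact isOpen_Ioo.is_const_of_deriv_eq_zero isPreconnected_Ioo
      (fun x hx => (hg x hx).differentiableAt.differentiableWithinAt)
      (fun x hx => (hg x hx).deriv) h hx0
  have hC := hconst (fun x => φ x + G * x) (fun ξ h => by
    have := (hφd ξ h).add ((hasDerivAt_id ξ).const_mul G)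
    have e : -G + G * 1 = 0 := by ring
    rw [e] at this
    exact this)
  have hT := hconst (fun x => f x * φ x) (fun ξ h => by
    have := (hf ξ h).hasDerivAt.mul (hφd ξ h)
    have e : deriv f ξ * φ ξ + f ξ * -G = 0 := by linarith [hrel ξ h]
    rw [e] at this
    exact this)
  refine ⟨hG, ?_, φ x0 + G * x0, f x0 * φ x0,
    mul_ne_zero (hfpos x0 hx0).ne' (hφ0 x0 hx0), ?_⟩
  · have := hp x0 hx0
    rw [hpG x0 hx0] at this
    linarith
  · intro ξ h
    have h1 : φ ξ = -G * ξ + (φ x0 + G * x0) := by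
      have := hC ξ h
      linarith
    refine ⟨h1, ?_⟩
    rw [← h1]
    exact hT ξ h
end

section
/- Let n ≥ 3 and m ≥ 2 be integers, let κ ∈ {−1, 1}, let λ, R̄ be real constants, and let G be a nonzero real constant satisfying m·(m−1)·G² = κ·(λ·(n−m) − R̄). Let I ⊆ ℝ be a nonempty open interval, let φ : I → ℝ be twice differentiable and nowhere vanishing, and let f : I → ℝ be twice differentiable and everywhere positive, such that (φ, f) satisfy system (A) on I together with the constraint κ·φ(ξ)²·f'(ξ)² + ((λ·(m−n) + R̄)/(m·(m−1)))·f(ξ)² = 0 for all ξ ∈ I. Then there exists ε ∈ {−1, 1} such that φ(ξ)·f'(ξ) = ε·G·f(ξ) for all ξ ∈ I and φ satisfies system (B) with ε·G in place of G on I. -/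
/-- a solution (φ, f) of system (A) subject to the first-integral
constraint κφ²(f')² + ((λ(m−n)+R̄)/(m(m−1)))f² = 0, where
m(m−1)G² = κ(λ(n−m) − R̄) and G ≠ 0, satisfies φ·f' = εG·f for some sign ε,
and φ solves system (B) with εG in place of G. -/
theorem stmt9 (n m : ℕ) (hn : 3 ≤ n) (hm : 2 ≤ m) (κ lam Rbar G : ℝ)
    (hκ : κ = -1 ∨ κ = 1) (hG : G ≠ 0)
    (hGdef : (m : ℝ) * ((m : ℝ) - 1) * G ^ 2 = κ * (lam * ((n : ℝ) - (m : ℝ)) - Rbar))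
    (a b : ℝ) (hab : a < b) (φ f : ℝ → ℝ)
    (hφ : ∀ ξ ∈ Set.Ioo a b, DifferentiableAt ℝ φ ξ)
    (hφ' : ∀ ξ ∈ Set.Ioo a b, DifferentiableAt ℝ (deriv φ) ξ)
    (hf : ∀ ξ ∈ Set.Ioo a b, DifferentiableAt ℝ f ξ)
    (hf' : ∀ ξ ∈ Set.Ioo a b, DifferentiableAt ℝ (deriv f) ξ)
    (hφ0 : ∀ ξ ∈ Set.Ioo a b, φ ξ ≠ 0)
    (hfpos : ∀ ξ ∈ Set.Ioo a b, 0 < f ξ)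
    (hA1 : ∀ ξ ∈ Set.Ioo a b,
      ((n : ℝ) - 2) * f ξ * deriv (deriv φ) ξ - (m : ℝ) * deriv (deriv f) ξ * φ ξ
        - 2 * (m : ℝ) * deriv φ ξ * deriv f ξ = 0)
    (hA2 : ∀ ξ ∈ Set.Ioo a b,
      f ξ * φ ξ * deriv (deriv φ) ξ - ((n : ℝ) - 1) * f ξ * (deriv φ ξ) ^ 2
        + (m : ℝ) * φ ξ * deriv φ ξ * deriv f ξ = κ * lam * f ξ)
    (hA3 : ∀ ξ ∈ Set.Ioo a b,
      ((n : ℝ) - 2) * f ξ * φ ξ * deriv φ ξ * deriv f ξ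
        - ((m : ℝ) - 1) * (φ ξ) ^ 2 * (deriv f ξ) ^ 2
        - f ξ * deriv (deriv f) ξ * (φ ξ) ^ 2 = κ * lam * (f ξ) ^ 2)
    (hconstr : ∀ ξ ∈ Set.Ioo a b,
      κ * (φ ξ) ^ 2 * (deriv f ξ) ^ 2
        + ((lam * ((m : ℝ) - (n : ℝ)) + Rbar) / ((m : ℝ) * ((m : ℝ) - 1))) * (f ξ) ^ 2 = 0) :
    ∃ ε : ℝ, (ε = -1 ∨ ε = 1) ∧
      (∀ ξ ∈ Set.Ioo a b, φ ξ * deriv f ξ = ε * G * f ξ) ∧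
      (∀ ξ ∈ Set.Ioo a b,
        ((n : ℝ) - 2) * φ ξ * deriv (deriv φ) ξ - (m : ℝ) * (ε * G) * deriv φ ξ
          = (m : ℝ) * (ε * G) ^ 2) ∧
      (∀ ξ ∈ Set.Ioo a b,
        φ ξ * deriv (deriv φ) ξ - ((n : ℝ) - 1) * (deriv φ ξ) ^ 2
          + (m : ℝ) * (ε * G) * deriv φ ξ = κ * lam) ∧
      (∀ ξ ∈ Set.Ioo a b,
        ((n : ℝ) - 1) * (ε * G) * deriv φ ξ - (m : ℝ) * (ε * G) ^ 2 = κ * lam) := by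
  have hm' : (2 : ℝ) ≤ m := by exact_mod_cast hm
  have hκ2 : κ ^ 2 = 1 := by rcases hκ with h | h <;> rw [h] <;> norm_num
  have hκ0 : κ ≠ 0 := by rcases hκ with h | h <;> rw [h] <;> norm_num
  have hM : (m : ℝ) * ((m : ℝ) - 1) ≠ 0 := by
    have : 0 < (m : ℝ) * ((m : ℝ) - 1) := by apply mul_pos <;> linarith
    exact this.ne'
  have hq : (lam * ((m : ℝ) - (n : ℝ)) + Rbar) / ((m : ℝ) * ((m : ℝ) - 1)) = -κ * G ^ 2 := by
    rw [div_eq_iff hM]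
    linear_combination (κ) * hGdef - (lam * ((m : ℝ) - (n : ℝ)) + Rbar) * hκ2
  have hsq : ∀ ξ ∈ Set.Ioo a b, (φ ξ * deriv f ξ) ^ 2 = (G * f ξ) ^ 2 := by
    intro ξ hξ
    have h := hconstr ξ hξ
    rw [hq] at h
    apply mul_left_cancel₀ hκ0
    linear_combination h
  have hcf : ContinuousOn f (Set.Ioo a b) :=
    fun x hx => (hf x hx).continuousAt.continuousWithinAt
  have hcf' : ContinuousOn (deriv f) (Set.Ioo a b) :=
    fun x hx => (hf' x hx).continuousAt.continuousWithinAt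
  have hcφ : ContinuousOn φ (Set.Ioo a b) :=
    fun x hx => (hφ x hx).continuousAt.continuousWithinAt
  have key : ∃ ε : ℝ, (ε = -1 ∨ ε = 1) ∧
      (∀ ξ ∈ Set.Ioo a b, φ ξ * deriv f ξ = ε * G * f ξ) := by
    have h := isPreconnected_Ioo.eq_or_eq_neg_of_sq_eq (S := Set.Ioo a b)
      (f := fun x => φ x * deriv f x) (g := fun x => G * f x)
      (hcφ.mul hcf') (continuousOn_const.mul hcf) (fun x hx => hsq x hx)
      (fun {x} hx => mul_ne_zero hG (hfpos x hx).ne')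
    rcases h with h | h
    · refine ⟨1, Or.inr rfl, fun ξ hξ => ?_⟩
      have := h hξ
      simp only at this
      linarith
    · refine ⟨-1, Or.inl rfl, fun ξ hξ => ?_⟩
      have := h hξ
      simp only [Pi.neg_apply] at this
      linarith
  obtain ⟨ε, hε, hH⟩ := key
  have hD : ∀ ξ ∈ Set.Ioo a b,
      deriv φ ξ * deriv f ξ + φ ξ * deriv (deriv f) ξ = ε * G * deriv f ξ := by
    intro ξ hξ
    have h1 := (hφ ξ hξ).hasDerivAt.mul (hf' ξ hξ).hasDerivAt
    have h2 := (hf ξ hξ).hasDerivAt.const_mul (ε * G)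
    have he : (φ * deriv f) =ᶠ[nhds ξ] (fun x => ε * G * f x) := by
      filter_upwards [isOpen_Ioo.mem_nhds hξ] with x hx using hH x hx
    exact h1.unique (h2.congr_of_eventuallyEq he)
  refine ⟨ε, hε, hH, fun ξ hξ => ?_, fun ξ hξ => ?_, fun ξ hξ => ?_⟩
  · apply mul_left_cancel₀ (hfpos ξ hξ).ne'
    linear_combination φ ξ * hA1 ξ hξ + m * φ ξ * hD ξ hξ
      + (m * ε * G + m * deriv φ ξ) * hH ξ hξ
  · apply mul_left_cancel₀ (hfpos ξ hξ).ne'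
    linear_combination hA2 ξ hξ - m * deriv φ ξ * hH ξ hξ
  · apply mul_left_cancel₀ (pow_ne_zero 2 (hfpos ξ hξ).ne')
    linear_combination hA3 ξ hξ + f ξ * φ ξ * hD ξ hξ
      - (((n : ℝ) - 1) * f ξ * deriv φ ξ - ε * G * f ξ) * hH ξ hξ
      + ((m : ℝ) - 1) * (φ ξ * deriv f ξ + ε * G * f ξ) * hH ξ hξ
end
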